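/- Let ψ ∈ S^2 and φ an automorphism of D. Then the operator norm of the weighted composition operator W_{ψ,φ} on S^2 satisfies ‖ψ‖_{S^2} ≤ ‖W_{ψ,φ}‖ ≤ [(1 + 8π²/3)·(1+|φ(0)|)/(1−|φ(0)|)]^{1/2} ‖ψ‖_{S^2}. -/

import Mathlib

open Metric Filter

noncomputable def taylorCoeff (f : ℂ → ℂ) (n : ℕ) : ℂ :=
  iteratedDeriv n f 0 / n.factorial

/-- Membership in `S²`: `f` is analytic on the open unit disk, equals its Taylor
series there, and its coefficients satisfy `Σ n² |a n|² < ∞`. -/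
def MemS2 (f : ℂ → ℂ) : Prop :=
  AnalyticOn ℂ f (ball (0:ℂ) 1) ∧
  (∀ z ∈ ball (0:ℂ) 1, HasSum (fun n : ℕ => taylorCoeff f n * z ^ n) (f z)) ∧
  Summable (fun n : ℕ => ((n : ℝ))^2 * ‖taylorCoeff f n‖^2)

/-- The square of the `S²` norm: `|a₀|² + Σ_{n≥1} n² |aₙ|²`. -/
noncomputable def s2NormSq (f : ℂ → ℂ) : ℝ :=
  ‖taylorCoeff f 0‖^2 + ∑' n : ℕ, ((n : ℝ) + 1)^2 * ‖taylorCoeff f (n+1)‖^2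

noncomputable def s2Norm (f : ℂ → ℂ) : ℝ := Real.sqrt (s2NormSq f)

/-- The square of the `H²` norm, in terms of Taylor coefficients. -/
noncomputable def h2NormSq (f : ℂ → ℂ) : ℝ := ∑' n : ℕ, ‖taylorCoeff f n‖^2

noncomputable def h2Norm (f : ℂ → ℂ) : ℝ := Real.sqrt (h2NormSq f)

/-- An operator on functions is bounded on `S²`. -/
def BoundedOpS2 (T : (ℂ → ℂ) → (ℂ → ℂ)) : Prop :=
  (∀ f, MemS2 f → MemS2 (T f)) ∧
  ∃ C : ℝ, ∀ f, MemS2 f → s2Norm (T f) ≤ C * s2Norm f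

/-- The operator norm of an operator on `S²`. -/
noncomputable def opNormS2 (T : (ℂ → ℂ) → (ℂ → ℂ)) : ℝ :=
  sInf {C : ℝ | 0 ≤ C ∧ ∀ f, MemS2 f → s2Norm (T f) ≤ C * s2Norm f}

/-- An (analytic) automorphism of the unit disk. -/
def IsDiskAut (φ : ℂ → ℂ) : Prop :=
  AnalyticOn ℂ φ (ball (0:ℂ) 1) ∧ Set.BijOn φ (ball (0:ℂ) 1) (ball (0:ℂ) 1)

open Complex in
lemma aux_poly_re (c : ℕ → ℂ) (N : ℕ) :
    ∃ q : ℂ → ℂ, Differentiable ℂ q ∧ (q 0).re = ∑ n ∈ Finset.range N, ‖c n‖ ^ 2 ∧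
      ∀ z : ℂ, ‖z‖ = 1 → ‖∑ n ∈ Finset.range N, c n * z ^ n‖ ^ 2 = (q z).re := by
  induction N with
  | zero => exact ⟨fun _ => 0, by fun_prop, by simp, by simp⟩
  | succ N ih =>
    obtain ⟨q, hq, hq0, hqz⟩ := ih
    refine ⟨fun z => q z + ((‖c N‖ ^ 2 : ℝ) : ℂ) +
      2 * (c N * ∑ n ∈ Finset.range N, (starRingEnd ℂ) (c n) * z ^ (N - n)), by fun_prop, ?_, ?_⟩
    · have h0 : ∑ n ∈ Finset.range N, (starRingEnd ℂ) (c n) * (0:ℂ) ^ (N - n) = 0 := by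
        apply Finset.sum_eq_zero
        intro n hn
        have : N - n ≠ 0 := by have := Finset.mem_range.1 hn; omega
        simp [this]
      beta_reduce
      rw [Finset.sum_range_succ, h0, ← hq0]
      simp only [mul_zero, add_zero, add_re, ofReal_re]
    · intro z hz
      have hconj : ∑ n ∈ Finset.range N, (starRingEnd ℂ) (c n) * z ^ (N - n) =
          z ^ N * (starRingEnd ℂ) (∑ n ∈ Finset.range N, c n * z ^ n) := by
        rw [map_sum, Finset.mul_sum]
        apply Finset.sum_congr rfl
        intro n hn
        have hnN := Finset.mem_range.1 hn
        have h1 : z * (starRingEnd ℂ) z = 1 := by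
          rw [mul_conj, normSq_eq_norm_sq, hz]; simp
        have h2 : z ^ N = z ^ (N - n) * z ^ n := by rw [← pow_add]; congr 1; omega
        rw [h2, map_mul, map_pow]
        calc _ = (starRingEnd ℂ) (c n) * z ^ (N - n) * (z * (starRingEnd ℂ) z) ^ n := by
              rw [h1]; simp
          _ = _ := by rw [mul_pow]; ring
      beta_reduce
      rw [Finset.sum_range_succ, hconj]
      set p := ∑ n ∈ Finset.range N, c n * z ^ n with hp
      have := hqz z hz
      rw [← hp] at this
      have h3 : ‖p + c N * z ^ N‖ ^ 2 = ‖p‖ ^ 2 + ‖c N * z ^ N‖ ^ 2 +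
          2 * ((c N * z ^ N) * (starRingEnd ℂ) p).re := by
        rw [← normSq_eq_norm_sq, ← normSq_eq_norm_sq, ← normSq_eq_norm_sq, add_comm p, normSq_add]
        ring
      rw [h3, this, norm_mul, norm_pow, hz]
      simp only [add_re, ofReal_re, mul_re (2:ℂ)]
      simp [mul_assoc]

open Complex in
lemma aux_circ_re {q : ℂ → ℂ} (hq : Differentiable ℂ q) :
    Real.circleAverage (fun z => (q z).re) 0 1 = (q 0).re := by
  have h1 : Real.circleAverage q 0 1 = q 0 := hq.diffContOnCl.circleAverage
  have h2 := Complex.reCLM.circleAverage_comp_comm (c := 0) (R := 1) (f := q)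
    (hq.continuous.continuousOn.circleIntegrable zero_le_one)
  rw [h1] at h2
  exact h2

lemma aux_parseval_poly (c : ℕ → ℂ) (N : ℕ) (r : ℝ) :
    Real.circleAverage (fun z => ‖∑ n ∈ Finset.range N, c n * z ^ n‖ ^ 2) 0 r =
      ∑ n ∈ Finset.range N, ‖c n‖ ^ 2 * (r ^ n) ^ 2 := by
  obtain ⟨q, hq, hq0, hqz⟩ := aux_poly_re (fun n => c n * (r:ℂ) ^ n) N
  rw [Real.circleAverage_eq_circleAverage_zero_one]
  have : Real.circleAverage (fun z : ℂ => ‖∑ n ∈ Finset.range N, c n * ((r:ℂ) * z + 0) ^ n‖ ^ 2) 0 1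
     = Real.circleAverage (fun z => (q z).re) 0 1 := by
    apply Real.circleAverage_congr_sphere
    intro z hz
    have hz : ‖z‖ = 1 := by simpa using hz
    simp only [← hqz z hz, add_zero, mul_pow, mul_assoc]
  rw [this, aux_circ_re hq, hq0]
  apply Finset.sum_congr rfl
  intro n _
  rw [norm_mul, mul_pow, norm_pow, Complex.norm_real, Real.norm_eq_abs, ← abs_pow, sq_abs]

lemma aux_hasSum {F : ℂ → ℂ} (hF : DifferentiableOn ℂ F (ball 0 1)) {z : ℂ} (hz : z ∈ ball (0:ℂ) 1) :
    HasSum (fun n : ℕ => taylorCoeff F n * z ^ n) (F z) := by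
  have := Complex.hasSum_taylorSeries_on_ball hF hz
  convert! this using 2 with n
  simp [taylorCoeff]; ring

lemma aux_parseval {F : ℂ → ℂ} (hF : DifferentiableOn ℂ F (ball 0 1)) {r : ℝ}
    (hr0 : 0 ≤ r) (hr : r < 1) :
    Tendsto (fun N => ∑ n ∈ Finset.range N, ‖taylorCoeff F n‖ ^ 2 * (r ^ n) ^ 2) atTop
      (nhds (Real.circleAverage (fun z => ‖F z‖ ^ 2) 0 r)) := by
  simp_rw [← aux_parseval_poly]
  have hmem : ∀ θ, circleMap 0 r θ ∈ ball (0:ℂ) 1 := by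
    intro θ; simp [abs_of_nonneg hr0, hr]
  have hs : Summable (fun n : ℕ => ‖taylorCoeff F n‖ * r ^ n) := by
    have := (aux_hasSum hF (z := (r:ℂ)) (by simp [abs_of_nonneg hr0, hr])).summable.norm
    simpa [abs_of_nonneg hr0] using this
  unfold Real.circleAverage
  apply Tendsto.const_smul
  apply intervalIntegral.tendsto_integral_filter_of_dominated_convergence
    (fun _ => (∑' n : ℕ, ‖taylorCoeff F n‖ * r ^ n) ^ 2)
  · refine Eventually.of_forall fun N => ?_
    apply Continuous.aestronglyMeasurable
    fun_prop
  · refine Eventually.of_forall fun N => Eventually.of_forall fun θ _ => ?_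
    rw [norm_pow, norm_norm]
    gcongr
    refine (norm_sum_le _ _).trans ?_
    refine le_trans (le_of_eq ?_) (hs.sum_le_tsum (Finset.range N) (fun n _ => by positivity))
    apply Finset.sum_congr rfl
    intro n _
    simp [abs_of_nonneg hr0]
  · simp
  · refine Eventually.of_forall fun θ _ => ?_
    exact ((aux_hasSum hF (hmem θ)).tendsto_sum_nat.norm).pow 2

lemma aux_avg_le {F : ℂ → ℂ} (hF : DifferentiableOn ℂ F (ball 0 1)) {r D : ℝ}
    (hr0 : 0 ≤ r) (hr : r < 1)
    (hD : ∀ N, ∑ n ∈ Finset.range N, ‖taylorCoeff F n‖ ^ 2 ≤ D) :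
    Real.circleAverage (fun z => ‖F z‖ ^ 2) 0 r ≤ D := by
  refine le_of_tendsto' (aux_parseval hF hr0 hr) fun N => (Finset.sum_le_sum fun n _ => ?_).trans (hD N)
  have : (r ^ n) ^ 2 ≤ 1 := pow_le_one₀ (by positivity) (pow_le_one₀ hr0 hr.le)
  exact mul_le_of_le_one_right (by positivity) this

lemma aux_bessel {F : ℂ → ℂ} (hF : DifferentiableOn ℂ F (ball 0 1)) {r : ℝ}
    (hr0 : 0 ≤ r) (hr : r < 1) (N : ℕ) :
    ∑ n ∈ Finset.range N, ‖taylorCoeff F n‖ ^ 2 * (r ^ n) ^ 2 ≤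
      Real.circleAverage (fun z => ‖F z‖ ^ 2) 0 r := by
  refine ge_of_tendsto (aux_parseval hF hr0 hr) ?_
  filter_upwards [eventually_ge_atTop N] with M hM
  apply Finset.sum_le_sum_of_subset_of_nonneg
  · simpa using hM
  · intros; positivity

noncomputable def mob (α z : ℂ) : ℂ := (z - α) / (1 - (starRingEnd ℂ) α * z)

lemma mob_den {α z : ℂ} (hα : ‖α‖ < 1) (hz : ‖z‖ ≤ 1) : 1 - (starRingEnd ℂ) α * z ≠ 0 := by
  intro h
  have h1 : (starRingEnd ℂ) α * z = 1 := (sub_eq_zero.1 h).symm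
  have h2 : ‖(starRingEnd ℂ) α * z‖ < 1 := by
    rw [norm_mul, RCLike.norm_conj]
    calc ‖α‖ * ‖z‖ ≤ ‖α‖ * 1 := by gcongr
      _ < 1 := by simpa using hα
  rw [h1] at h2
  simp at h2

lemma mob_normsq (α z : ℂ) : ‖1 - (starRingEnd ℂ) α * z‖ ^ 2 - ‖z - α‖ ^ 2 =
    (1 - ‖α‖ ^ 2) * (1 - ‖z‖ ^ 2) := by
  simp only [← Complex.normSq_eq_norm_sq, Complex.normSq_apply, Complex.sub_re, Complex.sub_im,
    Complex.mul_re, Complex.mul_im, Complex.conj_re, Complex.conj_im, Complex.one_re, Complex.one_im]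
  ring

lemma mob_lt {α z : ℂ} (hα : ‖α‖ < 1) (hz : ‖z‖ < 1) : ‖mob α z‖ < 1 := by
  have hd := norm_pos_iff.2 (mob_den hα hz.le)
  rw [mob, norm_div, div_lt_one hd]
  have h := mob_normsq α z
  have h1 : 0 < (1 - ‖α‖ ^ 2) * (1 - ‖z‖ ^ 2) := by
    apply mul_pos <;> nlinarith [norm_nonneg α, norm_nonneg z]
  nlinarith [norm_nonneg (z - α)]

lemma mob_eq_one {α z : ℂ} (hα : ‖α‖ < 1) (hz : ‖z‖ = 1) : ‖mob α z‖ = 1 := by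
  have hd := norm_pos_iff.2 (mob_den hα hz.le)
  rw [mob, norm_div, div_eq_one_iff_eq hd.ne']
  have h := mob_normsq α z
  rw [hz] at h
  have : ‖z - α‖ ^ 2 = ‖1 - (starRingEnd ℂ) α * z‖ ^ 2 := by linarith
  exact (pow_left_inj₀ (norm_nonneg _) (norm_nonneg _) two_ne_zero).1 this

lemma mob_hasDerivAt {α z : ℂ} (hα : ‖α‖ < 1) (hz : ‖z‖ ≤ 1) :
    HasDerivAt (mob α) ((1 - ‖α‖ ^ 2) / (1 - (starRingEnd ℂ) α * z) ^ 2) z := by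
  have hd := mob_den hα hz
  have h1 : HasDerivAt (fun z => z - α) 1 z := (hasDerivAt_id z).sub_const α
  have h2 : HasDerivAt (fun z => 1 - (starRingEnd ℂ) α * z) (-((starRingEnd ℂ) α * 1)) z :=
    ((hasDerivAt_id z).const_mul _).const_sub 1
  convert! h1.div h2 hd using 2
  have : ((‖α‖:ℂ)) ^ 2 = α * (starRingEnd ℂ) α := by
    rw [Complex.mul_conj, Complex.normSq_eq_norm_sq]; simp
  rw [this]; ring

lemma mob_inv {α z : ℂ} (hα : ‖α‖ < 1) (hz : ‖z‖ < 1) : mob (-α) (mob α z) = z := by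
  have hd := mob_den hα hz.le
  have hd2 := mob_den (α := -α) (by simpa using hα) (mob_lt hα hz).le
  have hd3 := mob_den hα hα.le
  unfold mob at *
  rw [div_eq_iff hd2]
  rw [map_neg]
  have key := div_mul_cancel₀ (z - α) hd
  generalize (z - α) / (1 - (starRingEnd ℂ) α * z) = t at *
  linear_combination key

open Topology in
lemma aux_inverse {χ : ℂ → ℂ} (hχ : AnalyticOnNhd ℂ χ (ball 0 1))
    (hb : Set.BijOn χ (ball 0 1) (ball 0 1)) :
    ∃ η : ℂ → ℂ, DifferentiableOn ℂ η (ball 0 1) ∧ Set.MapsTo η (ball 0 1) (ball 0 1) ∧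
      (∀ z ∈ ball (0:ℂ) 1, η (χ z) = z) ∧ (∀ w ∈ ball (0:ℂ) 1, χ (η w) = w) := by
  set η := Function.invFunOn χ (ball 0 1) with hη
  have hinv : Set.InvOn η χ (ball 0 1) (ball 0 1) := hb.invOn_invFunOn
  have hl : ∀ z ∈ ball (0:ℂ) 1, η (χ z) = z := fun z hz => hinv.1 hz
  have hr : ∀ w ∈ ball (0:ℂ) 1, χ (η w) = w := fun z hz => hinv.2 hz
  have hm : Set.MapsTo η (ball 0 1) (ball 0 1) := hb.surjOn.mapsTo_invFunOn
  have hnc : ∀ z ∈ ball (0:ℂ) 1, ¬ ∀ᶠ x in 𝓝 z, χ x = χ z := by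
    intro z hz h
    have h1 : ∀ᶠ x in 𝓝[≠] z, x = z := by
      have : ∀ᶠ x in 𝓝 z, x = z := by
        filter_upwards [h, isOpen_ball.mem_nhds hz] with x hx hx'
        exact hb.injOn hx' hz hx
      exact this.filter_mono nhdsWithin_le_nhds
    have h2 : ∀ᶠ x in 𝓝[≠] z, x ≠ z := eventually_mem_nhdsWithin
    obtain ⟨x, hx1, hx2⟩ := (h1.and h2).exists
    exact hx2 hx1
  have hcont : ∀ w ∈ ball (0:ℂ) 1, ContinuousAt η w := by
    intro w hw
    have hz := hm hw
    have hmap := ((hχ _ hz).eventually_constant_or_nhds_le_map_nhds).resolve_left (hnc _ hz)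
    rw [hr w hw] at hmap
    intro V hV
    have : χ '' (V ∩ ball 0 1) ∈ 𝓝 w :=
      hmap (image_mem_map (inter_mem hV (isOpen_ball.mem_nhds hz)))
    rw [mem_map]
    filter_upwards [this]
    rintro y ⟨x, ⟨hxV, hxb⟩, rfl⟩
    rw [Set.mem_preimage, hl x hxb]; exact hxV
  refine ⟨η, ?_, hm, hl, hr⟩
  intro w hw
  apply DifferentiableAt.differentiableWithinAt
  apply AnalyticAt.differentiableAt
  apply Complex.analyticAt_of_differentiable_on_punctured_nhds_of_continuousAt _ (hcont w hw)
  have hz := hm hw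
  have hder : ∀ᶠ x in 𝓝[≠] (η w), deriv χ x ≠ 0 := by
    refine ((hχ _ hz).deriv.eventually_eq_zero_or_eventually_ne_zero).resolve_left fun h => hnc _ hz ?_
    obtain ⟨ε, hε, hball⟩ := Metric.eventually_nhds_iff_ball.1 (h.and (isOpen_ball.mem_nhds hz))
    filter_upwards [ball_mem_nhds _ hε] with x hx
    exact (convex_ball (η w) ε).is_const_of_fderivWithin_eq_zero (𝕜 := ℂ) (f := χ)
      (fun y hy => (hχ y (hball y hy).2).differentiableAt.differentiableWithinAt)
      (fun y hy => by
        rw [fderivWithin_of_isOpen isOpen_ball hy]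
        ext; simp [(hball y hy).1])
      hx (mem_ball_self hε)
  have htend : Tendsto η (𝓝[≠] w) (𝓝[≠] (η w)) := by
    apply tendsto_nhdsWithin_of_tendsto_nhds_of_eventually_within
    · exact (hcont w hw).tendsto.mono_left nhdsWithin_le_nhds
    · filter_upwards [eventually_mem_nhdsWithin, nhdsWithin_le_nhds (isOpen_ball.mem_nhds hw)] with y hy hyb
      intro h
      apply hy
      rw [Set.mem_singleton_iff] at h ⊢
      rw [← hr y hyb, ← hr w hw, h]
  filter_upwards [htend.eventually hder, nhdsWithin_le_nhds (isOpen_ball.mem_nhds hw)] with y hy hyb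
  refine (HasDerivAt.of_local_left_inverse (hcont y hyb)
    ((hχ _ (hm hyb)).differentiableAt.hasDerivAt) hy ?_).differentiableAt
  filter_upwards [isOpen_ball.mem_nhds hyb] with x hx using hr x hx

lemma mob_diffOn {α : ℂ} (hα : ‖α‖ < 1) : DifferentiableOn ℂ (mob α) (ball 0 1) := fun z hz =>
  (mob_hasDerivAt hα (by simpa using (mem_ball_zero_iff.1 hz).le)).differentiableAt.differentiableWithinAt

lemma aux_classify {φ : ℂ → ℂ} (hφ : IsDiskAut φ) :
    ∃ c α : ℂ, ‖c‖ = 1 ∧ ‖α‖ < 1 ∧ ∀ z ∈ ball (0:ℂ) 1, φ z = c * mob α z := by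
  obtain ⟨ha, hb⟩ := hφ
  have hnhd : AnalyticOnNhd ℂ φ (ball 0 1) := (isOpen_ball.analyticOn_iff_analyticOnNhd).1 ha
  obtain ⟨η, hηd, hηm, hl, hr⟩ := aux_inverse hnhd hb
  set α := η 0 with hα
  have h0 : (0:ℂ) ∈ ball (0:ℂ) 1 := by simp
  have hα1 : ‖α‖ < 1 := mem_ball_zero_iff.1 (hηm h0)
  have hα1' : ‖-α‖ < 1 := by simpa using hα1
  have hφα : φ α = 0 := hr 0 h0
  have hmm : ∀ {a : ℂ}, ‖a‖ < 1 → Set.MapsTo (mob a) (ball 0 1) (ball 0 1) := fun {a} h z hz =>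
    mem_ball_zero_iff.2 (mob_lt h (mem_ball_zero_iff.1 hz))
  set χ : ℂ → ℂ := φ ∘ mob (-α) with hχ
  have hχd : DifferentiableOn ℂ χ (ball 0 1) :=
    hnhd.differentiableOn.comp (mob_diffOn hα1') (hmm hα1')
  have hχm : Set.MapsTo χ (ball 0 1) (ball 0 1) := hb.mapsTo.comp (hmm hα1')
  have hχ0 : χ 0 = 0 := by simp [hχ, mob, hφα]
  have hκd : DifferentiableOn ℂ (mob α ∘ η) (ball 0 1) := (mob_diffOn hα1).comp hηd hηm
  have hκm : Set.MapsTo (mob α ∘ η) (ball 0 1) (ball 0 1) := (hmm hα1).comp hηm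
  have hκ0 : (mob α ∘ η) 0 = 0 := by simp [mob, ← hα]
  have hn : ∀ z : ℂ, ‖z‖ < 1 → ‖χ z‖ = ‖z‖ := by
    intro z hz
    apply le_antisymm
    · exact Complex.norm_le_norm_of_mapsTo_ball hχd (hχm.mono_right ball_subset_closedBall) hχ0 hz
    · have hz' : ‖χ z‖ < 1 := mem_ball_zero_iff.1 (hχm (mem_ball_zero_iff.2 hz))
      have := Complex.norm_le_norm_of_mapsTo_ball hκd (hκm.mono_right ball_subset_closedBall) hκ0 hz'
      have hi : (mob α ∘ η) (χ z) = z := by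
        simp only [hχ, Function.comp]
        rw [hl _ (hmm hα1' (mem_ball_zero_iff.2 hz))]
        simpa using mob_inv hα1' hz
      rwa [hi] at this
  obtain ⟨c, hc, heq⟩ := Complex.affine_of_mapsTo_ball_of_exists_norm_dslope_eq_div' (c := 0) (R₁ := 1)
    (R₂ := 1) hχd (by rw [hχ0]; exact hχm.mono_right ball_subset_closedBall)
    ⟨1/2, by simp; norm_num, by
      rw [dslope_of_ne _ (by norm_num), slope_def_field, hχ0, norm_div, sub_zero, sub_zero,
        hn _ (by norm_num)]
      norm_num⟩
  refine ⟨c, α, by simpa using hc, hα1, fun z hz => ?_⟩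
  have := heq (hmm hα1 hz)
  simp only [hχ, Function.comp] at this
  rw [mob_inv hα1 (mem_ball_zero_iff.1 hz)] at this
  rw [this]
  have h2 : φ (mob (-α) 0) = 0 := hχ0
  simp [h2, mul_comm]

noncomputable def dmob (α z : ℂ) : ℂ := (1 - ‖α‖ ^ 2) / (1 - (starRingEnd ℂ) α * z) ^ 2

lemma dmob_norm {α z : ℂ} (hα : ‖α‖ < 1) (hz : ‖z‖ = 1) :
    ‖dmob α z‖ = (1 - ‖α‖ ^ 2) / ‖z - α‖ ^ 2 := by
  have h1 := mob_normsq α z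
  rw [hz] at h1
  have h2 : (1 - (‖α‖:ℂ) ^ 2) = ((1 - ‖α‖ ^ 2 : ℝ) : ℂ) := by push_cast; rfl
  rw [dmob, norm_div, norm_pow, h2, Complex.norm_real, Real.norm_eq_abs, abs_of_nonneg]
  · congr 1; linarith
  · nlinarith [norm_nonneg α]

lemma dmob_le {α z : ℂ} (hα : ‖α‖ < 1) (hz : ‖z‖ = 1) :
    (1 - ‖α‖ ^ 2) / ‖z - α‖ ^ 2 ≤ (1 + ‖α‖) / (1 - ‖α‖) := by
  have h1 : 1 - ‖α‖ ≤ ‖z - α‖ := by rw [← hz]; exact norm_sub_norm_le z α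
  have h2 : 0 < 1 - ‖α‖ := by linarith
  rw [div_le_div_iff₀ (by have := h2.trans_le h1; positivity) h2]
  have h3 : (1 - ‖α‖) ^ 2 ≤ ‖z - α‖ ^ 2 := by gcongr
  have h4 := norm_nonneg α
  calc (1 - ‖α‖ ^ 2) * (1 - ‖α‖) = (1 + ‖α‖) * (1 - ‖α‖) ^ 2 := by ring
    _ ≤ _ := by gcongr

lemma dmob_cont {α : ℂ} (hα : ‖α‖ < 1) : ContinuousOn (dmob α) (closedBall 0 1) := by
  unfold dmob
  apply ContinuousOn.div (by fun_prop) (by fun_prop)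
  intro z hz
  exact pow_ne_zero _ (mob_den hα (by simpa using hz))

lemma mob_cont {α : ℂ} (hα : ‖α‖ < 1) : ContinuousOn (mob α) (closedBall 0 1) := fun z hz =>
  (mob_hasDerivAt hα (by simpa using hz)).continuousAt.continuousWithinAt

lemma aux_poisson {c α : ℂ} (hc : ‖c‖ = 1) (hα : ‖α‖ < 1) (a : ℕ → ℂ) (N : ℕ) :
    Real.circleAverage
      (fun z => ‖c * dmob α z * ∑ n ∈ Finset.range N, a n * (c * mob α z) ^ n‖ ^ 2) 0 1 ≤
      (1 + ‖α‖) / (1 - ‖α‖) * ∑ n ∈ Finset.range N, ‖a n‖ ^ 2 := by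
  obtain ⟨q, hq, hq0, hqz⟩ := aux_poly_re a N
  set K := (1 + ‖α‖) / (1 - ‖α‖) with hK
  set Q : ℂ → ℂ := fun z => q (c * mob α z) with hQ
  have hQc : ContinuousOn Q (closedBall 0 1) :=
    hq.continuous.comp_continuousOn (continuousOn_const.mul (mob_cont hα))
  have hQd : DiffContOnCl ℂ Q (ball 0 1) := by
    refine ⟨?_, by rwa [closure_ball _ one_ne_zero]⟩
    exact hq.comp_differentiableOn ((mob_diffOn hα).const_mul c)
  have hP := hQd.circleAverage_poissonKernel_smul' (w := α) (by simpa using hα)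
  have hQα : Q α = q 0 := by simp [hQ, mob]
  have hPc : ContinuousOn (fun z : ℂ => (‖z - 0‖ ^ 2 - ‖α - 0‖ ^ 2) / ‖(z - 0) - (α - 0)‖ ^ 2)
      (sphere 0 1) := by
    apply ContinuousOn.div (by fun_prop) (by fun_prop)
    intro z hz
    have : ‖z‖ = 1 := by simpa using hz
    have : z - α ≠ 0 := by intro h; rw [sub_eq_zero.1 h] at this; linarith
    simpa using this
  have hcirc : CircleIntegrable (fun z : ℂ => ((‖z - 0‖ ^ 2 - ‖α - 0‖ ^ 2) / ‖(z - 0) - (α - 0)‖ ^ 2) • Q z)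
      0 1 :=
    (hPc.smul (hQc.mono sphere_subset_closedBall)).circleIntegrable zero_le_one
  have hre := Complex.reCLM.circleAverage_comp_comm hcirc
  rw [hP, hQα] at hre
  have hre' : (Complex.reCLM (q 0)) = ∑ n ∈ Finset.range N, ‖a n‖ ^ 2 := hq0
  rw [← hre', ← hre, ← smul_eq_mul, ← Real.circleAverage_smul]
  apply Real.circleAverage_mono
  · apply ContinuousOn.circleIntegrable zero_le_one
    apply ContinuousOn.mono _ (sphere_subset_closedBall (x := (0:ℂ)) (ε := 1))
    have := dmob_cont hα
    have := mob_cont hα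
    fun_prop
  · apply ContinuousOn.circleIntegrable zero_le_one
    apply ContinuousOn.const_smul
    exact Complex.continuous_re.comp_continuousOn (hPc.smul (hQc.mono sphere_subset_closedBall))
  · intro z hz
    have hz : ‖z‖ = 1 := by simpa using hz
    have hw : ‖c * mob α z‖ = 1 := by rw [norm_mul, hc, mob_eq_one hα hz, one_mul]
    rw [norm_mul, mul_pow, hqz _ hw, norm_mul, hc, one_mul, dmob_norm hα hz]
    have hnn : 0 ≤ (q (c * mob α z)).re := by rw [← hqz _ hw]; positivity
    have hle := dmob_le hα hz
    simp only [Pi.smul_apply, Function.comp, Complex.reCLM_apply, smul_eq_mul, Complex.smul_re, sub_zero, hz, hQ]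
    rw [one_pow, ← mul_assoc]
    gcongr
    rw [sq]
    gcongr
    exact div_nonneg (by nlinarith [norm_nonneg α]) (by positivity)

lemma taylorCoeff_deriv (f : ℂ → ℂ) (n : ℕ) :
    taylorCoeff (deriv f) n = (n + 1) * taylorCoeff f (n + 1) := by
  unfold taylorCoeff
  rw [iteratedDeriv_succ', Nat.factorial_succ]
  have h1 : (n.factorial : ℂ) ≠ 0 := by exact_mod_cast n.factorial_ne_zero
  have h2 : (n + 1 : ℂ) ≠ 0 := by exact_mod_cast n.succ_ne_zero
  push_cast
  field_simp

lemma norm_taylorCoeff_deriv (f : ℂ → ℂ) (n : ℕ) :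
    ‖taylorCoeff (deriv f) n‖ ^ 2 = ((n : ℝ) + 1) ^ 2 * ‖taylorCoeff f (n + 1)‖ ^ 2 := by
  rw [taylorCoeff_deriv, norm_mul, mul_pow]
  congr 2
  have : (n + 1 : ℂ) = ((n + 1 : ℝ) : ℂ) := by push_cast; rfl
  rw [this, Complex.norm_real, Real.norm_eq_abs, abs_of_nonneg (by positivity)]

lemma s2_sum {f : ℂ → ℂ} (hf : MemS2 f) (N : ℕ) :
    ∑ n ∈ Finset.range N, ((n : ℝ) + 1) ^ 2 * ‖taylorCoeff f (n + 1)‖ ^ 2 ≤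
      s2NormSq f - ‖taylorCoeff f 0‖ ^ 2 := by
  have h := (summable_nat_add_iff 1).2 hf.2.2
  have h' : Summable (fun n : ℕ => ((n : ℝ) + 1) ^ 2 * ‖taylorCoeff f (n + 1)‖ ^ 2) := by
    simpa using h
  unfold s2NormSq
  have := h'.sum_le_tsum (Finset.range N) (fun n _ => by positivity)
  linarith

lemma s2NormSq_nonneg (f : ℂ → ℂ) : 0 ≤ s2NormSq f := by
  unfold s2NormSq
  have : 0 ≤ ∑' n : ℕ, ((n : ℝ) + 1)^2 * ‖taylorCoeff f (n+1)‖^2 := tsum_nonneg fun n => by positivity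
  positivity

lemma s2_l1 {f : ℂ → ℂ} (hf : MemS2 f) (N : ℕ) :
    ∑ n ∈ Finset.range N, ‖taylorCoeff f n‖ ≤ Real.sqrt ((1 + Real.pi ^ 2 / 6) * s2NormSq f) := by
  cases N with
  | zero => simp
  | succ N =>
    apply Real.le_sqrt_of_sq_le
    rw [Finset.sum_range_succ']
    have hS := s2_sum hf N
    set T := ∑ n ∈ Finset.range N, ((n : ℝ) + 1) ^ 2 * ‖taylorCoeff f (n + 1)‖ ^ 2
    set Y := ∑ n ∈ Finset.range N, ‖taylorCoeff f (n + 1)‖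
    set X := ‖taylorCoeff f 0‖
    have hz : ∑ n ∈ Finset.range N, (1 / ((n : ℝ) + 1)) ^ 2 ≤ Real.pi ^ 2 / 6 := by
      have h1 := hasSum_zeta_two
      have h2 := h1.summable.sum_le_tsum (Finset.range (N + 1)) (fun n _ => by positivity)
      rw [h1.tsum_eq, Finset.sum_range_succ'] at h2
      simpa [div_pow] using h2
    have hY : Y ^ 2 ≤ (Real.pi ^ 2 / 6) * T := by
      have h := Finset.sum_mul_sq_le_sq_mul_sq (Finset.range N) (fun n => 1 / ((n : ℝ) + 1))
        (fun n => ((n : ℝ) + 1) * ‖taylorCoeff f (n + 1)‖)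
      have e1 : ∑ n ∈ Finset.range N, 1 / ((n : ℝ) + 1) * (((n : ℝ) + 1) * ‖taylorCoeff f (n + 1)‖) = Y := by
        apply Finset.sum_congr rfl
        intro n _
        have : (n : ℝ) + 1 ≠ 0 := by positivity
        field_simp
      rw [e1] at h
      refine h.trans ?_
      simp_rw [mul_pow]
      have hT : 0 ≤ T := Finset.sum_nonneg fun n _ => by positivity
      exact mul_le_mul_of_nonneg_right hz hT
    have hk : 0 < Real.pi ^ 2 / 6 := by positivity
    generalize Real.pi ^ 2 / 6 = k at *
    have h3 : 2 * X * Y ≤ k * X ^ 2 + T := by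
      have : k * (2 * X * Y) ≤ k * (k * X ^ 2 + T) := by nlinarith [sq_nonneg (k * X - Y)]
      exact le_of_mul_le_mul_left this hk
    have h4 : (1 + k) * (X ^ 2 + T) ≤ (1 + k) * s2NormSq f := by
      apply mul_le_mul_of_nonneg_left _ (by linarith)
      linarith
    nlinarith

lemma s2_poly_le {f : ℂ → ℂ} (hf : MemS2 f) (N : ℕ) {z : ℂ} (hz : ‖z‖ ≤ 1) :
    ‖∑ n ∈ Finset.range N, taylorCoeff f n * z ^ n‖ ^ 2 ≤ (1 + Real.pi ^ 2 / 6) * s2NormSq f := by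
  have h0 : 0 ≤ (1 + Real.pi ^ 2 / 6) * s2NormSq f := mul_nonneg (by positivity) (s2NormSq_nonneg f)
  rw [← Real.sq_sqrt h0]
  gcongr
  refine (norm_sum_le _ _).trans (le_trans (Finset.sum_le_sum fun n _ => ?_) (s2_l1 hf N))
  rw [norm_mul, norm_pow]
  exact mul_le_of_le_one_right (norm_nonneg _) (pow_le_one₀ (norm_nonneg _) hz)

lemma s2_sup {f : ℂ → ℂ} (hf : MemS2 f) {z : ℂ} (hz : ‖z‖ < 1) :
    ‖f z‖ ^ 2 ≤ (1 + Real.pi ^ 2 / 6) * s2NormSq f :=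
  le_of_tendsto' (((hf.2.1 z (by simpa using hz)).tendsto_sum_nat.norm).pow 2)
    fun N => s2_poly_le hf N hz.le

lemma aux_poly_deriv (a : ℕ → ℂ) (N : ℕ) (z : ℂ) :
    HasDerivAt (fun z => ∑ n ∈ Finset.range (N + 1), a n * z ^ n)
      (∑ n ∈ Finset.range N, (((n : ℂ) + 1) * a (n + 1)) * z ^ n) z := by
  simp_rw [Finset.sum_range_succ' _ N, pow_zero]
  refine HasDerivAt.add_const _ ?_
  apply HasDerivAt.fun_sum
  intro n _
  have := (hasDerivAt_pow (n + 1) z).const_mul (a (n + 1))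
  convert! this using 1
  push_cast
  ring

lemma aux_mainN {ψ f : ℂ → ℂ} (hψ : MemS2 ψ) (hf : MemS2 f) {c α : ℂ} (hc : ‖c‖ = 1)
    (hα : ‖α‖ < 1) (N M : ℕ) :
    ∑ n ∈ Finset.range M, ((n : ℝ) + 1) ^ 2 * ‖taylorCoeff
      (fun z => ψ z * ∑ k ∈ Finset.range (N + 1), taylorCoeff f k * (c * mob α z) ^ k) (n + 1)‖ ^ 2 ≤
    2 * ((1 + Real.pi ^ 2 / 6) * s2NormSq f) * (s2NormSq ψ - ‖taylorCoeff ψ 0‖ ^ 2) +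
    2 * ((1 + Real.pi ^ 2 / 6) * s2NormSq ψ) * ((1 + ‖α‖) / (1 - ‖α‖) * s2NormSq f) := by
  simp_rw [← norm_taylorCoeff_deriv]
  set m := 1 + Real.pi ^ 2 / 6 with hm
  have hm0 : 0 ≤ m := by positivity
  have hE := s2NormSq_nonneg f
  have hP := s2NormSq_nonneg ψ
  set E := s2NormSq f with hEdef
  set P := s2NormSq ψ with hPdef
  set p : ℂ → ℂ := fun w => ∑ k ∈ Finset.range (N + 1), taylorCoeff f k * w ^ k with hp
  set b : ℕ → ℂ := fun n => ((n : ℂ) + 1) * taylorCoeff f (n + 1) with hb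
  set p' : ℂ → ℂ := fun w => ∑ k ∈ Finset.range N, b k * w ^ k with hp'
  set h : ℂ → ℂ := fun z => ψ z * p (c * mob α z) with hh
  set G : ℂ → ℂ := fun z => c * dmob α z * p' (c * mob α z) with hG
  have hψd : DifferentiableOn ℂ ψ (ball 0 1) := hψ.1.differentiableOn
  have hpd : ∀ w, HasDerivAt p (p' w) w := fun w => aux_poly_deriv _ N w
  have hp'c : Continuous p' := by fun_prop
  have hder : ∀ z ∈ ball (0:ℂ) 1, HasDerivAt h (deriv ψ z * p (c * mob α z) + ψ z * G z) z := by
    intro z hz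
    have h1 := (hψd.differentiableAt (isOpen_ball.mem_nhds hz)).hasDerivAt
    have h2 : HasDerivAt (fun z => c * mob α z) (c * dmob α z) z :=
      (mob_hasDerivAt hα (mem_ball_zero_iff.1 hz).le).const_mul c
    have h3 := h1.mul ((hpd (c * mob α z)).comp z h2)
    convert! h3 using 1
    simp only [hG, Function.comp]; ring
  have hhd : DifferentiableOn ℂ h (ball 0 1) := fun z hz =>
    (hder z hz).differentiableAt.differentiableWithinAt
  have hh'd : DifferentiableOn ℂ (deriv h) (ball 0 1) := hhd.deriv isOpen_ball
  have hψ'd : DifferentiableOn ℂ (deriv ψ) (ball 0 1) := hψd.deriv isOpen_ball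
  have hGc : ContinuousOn G (closedBall 0 1) := by
    have := dmob_cont hα
    have := mob_cont hα
    apply ContinuousOn.mul (by fun_prop)
    exact hp'c.comp_continuousOn (by fun_prop)
  have hA : ContinuousOn (Real.circleAverage (fun z => ‖G z‖ ^ 2) 0) (Set.Icc 0 1) := by
    apply Real.ContinuousOn.circleAverage
    · apply (hGc.norm.pow 2).mono
      intro z hz
      simpa using hz.2
    · intro r hr; exact hr.1
  have hA1 : Real.circleAverage (fun z => ‖G z‖ ^ 2) 0 1 ≤ (1 + ‖α‖) / (1 - ‖α‖) * E := by
    refine (aux_poisson hc hα b N).trans ?_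
    have : 0 ≤ (1 + ‖α‖) / (1 - ‖α‖) := div_nonneg (by positivity) (by linarith)
    gcongr
    have h1 := s2_sum hf N
    simp_rw [hb, ← taylorCoeff_deriv, norm_taylorCoeff_deriv]
    have : 0 ≤ ‖taylorCoeff f 0‖ ^ 2 := by positivity
    linarith
  have hr : ∀ r ∈ Set.Ico (0:ℝ) 1, ∑ n ∈ Finset.range M, ‖taylorCoeff (deriv h) n‖ ^ 2 * (r ^ n) ^ 2 ≤
      2 * (m * E) * (P - ‖taylorCoeff ψ 0‖ ^ 2) +
      2 * (m * P) * Real.circleAverage (fun z => ‖G z‖ ^ 2) 0 r := by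
    intro r hr
    have hsub : sphere (0:ℂ) r ⊆ ball 0 1 := by
      intro z hz; have : ‖z‖ = r := by simpa using hz
      simpa [this] using hr.2
    have hi1 : CircleIntegrable (fun z => ‖deriv ψ z‖ ^ 2) 0 r :=
      ((hψ'd.continuousOn.mono hsub).norm.pow 2).circleIntegrable hr.1
    have hi2 : CircleIntegrable (fun z => ‖G z‖ ^ 2) 0 r :=
      ((hGc.mono (hsub.trans ball_subset_closedBall)).norm.pow 2).circleIntegrable hr.1
    have hi3 : CircleIntegrable (fun z => ‖deriv h z‖ ^ 2) 0 r :=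
      ((hh'd.continuousOn.mono hsub).norm.pow 2).circleIntegrable hr.1
    have hi1' : CircleIntegrable (fun z => (2 * (m * E)) • ‖deriv ψ z‖ ^ 2) 0 r :=
      (((hψ'd.continuousOn.mono hsub).norm.pow 2).const_smul (2 * (m * E))).circleIntegrable hr.1
    have hi2' : CircleIntegrable (fun z => (2 * (m * P)) • ‖G z‖ ^ 2) 0 r :=
      (((hGc.mono (hsub.trans ball_subset_closedBall)).norm.pow 2).const_smul (2 * (m * P))).circleIntegrable hr.1
    refine (aux_bessel hh'd hr.1 hr.2 M).trans ?_
    have step : Real.circleAverage (fun z => ‖deriv h z‖ ^ 2) 0 r ≤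
        Real.circleAverage (fun z => (2 * (m * E)) • ‖deriv ψ z‖ ^ 2 + (2 * (m * P)) • ‖G z‖ ^ 2) 0 r := by
      apply Real.circleAverage_mono hi3 (hi1'.add hi2')
      intro z hz
      rw [abs_of_nonneg hr.1] at hz
      have hzb := hsub hz
      have hz1 := mem_ball_zero_iff.1 hzb
      rw [(hder z hzb).deriv]
      have hw : ‖c * mob α z‖ ≤ 1 := by rw [norm_mul, hc, one_mul]; exact (mob_lt hα hz1).le
      have hp1 : ‖p (c * mob α z)‖ ^ 2 ≤ m * E := s2_poly_le hf (N + 1) hw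
      have hp2 : ‖ψ z‖ ^ 2 ≤ m * P := s2_sup hψ hz1
      have h1 : ‖deriv ψ z * p (c * mob α z) + ψ z * G z‖ ^ 2 ≤
          2 * ‖deriv ψ z * p (c * mob α z)‖ ^ 2 + 2 * ‖ψ z * G z‖ ^ 2 := by
        have := norm_add_le (deriv ψ z * p (c * mob α z)) (ψ z * G z)
        have h2 : ‖deriv ψ z * p (c * mob α z) + ψ z * G z‖ ^ 2 ≤
          (‖deriv ψ z * p (c * mob α z)‖ + ‖ψ z * G z‖) ^ 2 := by gcongr
        nlinarith [sq_nonneg (‖deriv ψ z * p (c * mob α z)‖ - ‖ψ z * G z‖)]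
      refine h1.trans ?_
      show _ ≤ (2 * (m * E)) • ‖deriv ψ z‖ ^ 2 + (2 * (m * P)) • ‖G z‖ ^ 2
      rw [norm_mul, norm_mul, mul_pow, mul_pow, smul_eq_mul, smul_eq_mul]
      have e1 : ‖deriv ψ z‖ ^ 2 * ‖p (c * mob α z)‖ ^ 2 ≤ ‖deriv ψ z‖ ^ 2 * (m * E) := by gcongr
      have e2 : ‖ψ z‖ ^ 2 * ‖G z‖ ^ 2 ≤ (m * P) * ‖G z‖ ^ 2 := by gcongr
      linarith
    refine step.trans ?_
    rw [Real.circleAverage_fun_add hi1' hi2', Real.circleAverage_fun_smul, Real.circleAverage_fun_smul,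
      smul_eq_mul, smul_eq_mul]
    gcongr
    apply aux_avg_le hψ'd hr.1 hr.2
    intro n
    simp_rw [norm_taylorCoeff_deriv]
    exact s2_sum hψ n
  have hne : (nhdsWithin (1:ℝ) (Set.Ico 0 1)).NeBot := by
    rw [← mem_closure_iff_nhdsWithin_neBot, closure_Ico (by norm_num)]; simp
  have hlim1 : Tendsto (fun r : ℝ => ∑ n ∈ Finset.range M, ‖taylorCoeff (deriv h) n‖ ^ 2 * (r ^ n) ^ 2)
      (nhdsWithin 1 (Set.Ico 0 1)) (nhds (∑ n ∈ Finset.range M, ‖taylorCoeff (deriv h) n‖ ^ 2)) := by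
    have : Continuous (fun r : ℝ => ∑ n ∈ Finset.range M, ‖taylorCoeff (deriv h) n‖ ^ 2 * (r ^ n) ^ 2) := by
      fun_prop
    have h1 := (this.tendsto 1).mono_left (nhdsWithin_le_nhds (s := Set.Ico (0:ℝ) 1))
    simpa using h1
  have hlim2 : Tendsto (fun r : ℝ => 2 * (m * E) * (P - ‖taylorCoeff ψ 0‖ ^ 2) +
      2 * (m * P) * Real.circleAverage (fun z => ‖G z‖ ^ 2) 0 r)
      (nhdsWithin 1 (Set.Ico 0 1)) (nhds (2 * (m * E) * (P - ‖taylorCoeff ψ 0‖ ^ 2) +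
      2 * (m * P) * Real.circleAverage (fun z => ‖G z‖ ^ 2) 0 1)) := by
    have h1 := (hA 1 (by simp)).tendsto.mono_left (nhdsWithin_mono 1 Set.Ico_subset_Icc_self)
    exact (h1.const_mul _).const_add _
  have hfin := le_of_tendsto_of_tendsto hlim1 hlim2 (eventually_mem_nhdsWithin.mono hr)
  refine hfin.trans ?_
  gcongr

lemma taylorCoeff_zero (f : ℂ → ℂ) : taylorCoeff f 0 = f 0 := by simp [taylorCoeff]

open Topology in
lemma aux_coeff_tendsto {g : ℂ → ℂ} {F : ℕ → ℂ → ℂ} (hg : DifferentiableOn ℂ g (ball 0 1))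
    (hF : ∀ N, DifferentiableOn ℂ (F N) (ball 0 1))
    (hu : TendstoUniformlyOn F g atTop (ball 0 1)) (n : ℕ) :
    Tendsto (fun N => taylorCoeff (F N) n) atTop (𝓝 (taylorCoeff g n)) := by
  have h0 : (0:ℂ) ∈ ball (0:ℂ) 1 := by simp
  have hsub : closedBall (0:ℂ) (1/2) ⊆ ball 0 1 := closedBall_subset_ball (by norm_num)
  have hcd : ∀ {k : ℂ → ℂ}, DifferentiableOn ℂ k (ball 0 1) → ContDiffAt ℂ n k 0 := fun {k} hk =>
    (hk.analyticAt (isOpen_ball.mem_nhds h0)).contDiffAt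
  unfold taylorCoeff
  apply Tendsto.div_const
  rw [Metric.tendsto_nhds]
  intro ε hε
  have hδ : 0 < ε * (1/2) ^ n / (2 * n.factorial) := by positivity
  filter_upwards [Metric.tendstoUniformlyOn_iff.1 hu _ hδ] with N hN
  rw [dist_eq_norm, ← iteratedDeriv_sub (hcd (hF N)) (hcd hg)]
  have := Complex.norm_iteratedDeriv_le_of_forall_mem_sphere_norm_le (c := 0) (R := 1/2) n
    (by norm_num) (f := F N - g) (C := ε * (1/2) ^ n / (2 * n.factorial))
    (DifferentiableOn.diffContOnCl (by
      rw [closure_ball _ (by norm_num)]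
      exact ((hF N).sub hg).mono hsub))
    (fun z hz => by
      have := (hN z (hsub (sphere_subset_closedBall hz))).le
      rw [dist_comm, dist_eq_norm] at this
      exact this)
  refine this.trans_lt ?_
  have hn : (n.factorial : ℝ) ≠ 0 := by positivity
  have : (n.factorial : ℝ) * (ε * (1/2) ^ n / (2 * n.factorial)) / (1/2) ^ n = ε / 2 := by
    field_simp
  rw [this]; linarith

lemma aux_main {ψ f : ℂ → ℂ} (hψ : MemS2 ψ) (hf : MemS2 f) {c α : ℂ} (hc : ‖c‖ = 1)
    (hα : ‖α‖ < 1) :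
    s2NormSq (fun z => ψ z * f (c * mob α z)) ≤
      (1 + 8 * Real.pi ^ 2 / 3) * ((1 + ‖α‖) / (1 - ‖α‖)) * s2NormSq ψ * s2NormSq f := by
  have hψd : DifferentiableOn ℂ ψ (ball 0 1) := hψ.1.differentiableOn
  have hφm : Set.MapsTo (fun z => c * mob α z) (ball (0:ℂ) 1) (ball 0 1) := by
    intro z hz
    rw [mem_ball_zero_iff] at *
    rw [norm_mul, hc, one_mul]; exact mob_lt hα hz
  have hφd : DifferentiableOn ℂ (fun z => c * mob α z) (ball (0:ℂ) 1) := (mob_diffOn hα).const_mul c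
  have hgd : DifferentiableOn ℂ (fun z => ψ z * f (c * mob α z)) (ball 0 1) :=
    hψd.mul (hf.1.differentiableOn.comp hφd hφm)
  set F : ℕ → ℂ → ℂ := fun N z =>
    ψ z * ∑ k ∈ Finset.range (N + 1), taylorCoeff f k * (c * mob α z) ^ k with hF
  have hFd : ∀ N, DifferentiableOn ℂ (F N) (ball 0 1) := by
    intro N
    apply hψd.mul
    apply DifferentiableOn.fun_sum
    intro k _
    exact (hφd.pow k).const_mul _
  have hsum : Summable (fun n => ‖taylorCoeff f n‖) :=
    summable_of_sum_range_le (fun n => norm_nonneg _) (s2_l1 hf)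
  have hu : TendstoUniformlyOn F (fun z => ψ z * f (c * mob α z)) atTop (ball 0 1) := by
    have h1 := tendstoUniformlyOn_tsum_nat hsum (f := fun n z => taylorCoeff f n * z ^ n)
      (s := ball (0:ℂ) 1) (fun n z hz => by
        rw [norm_mul, norm_pow]
        exact mul_le_of_le_one_right (norm_nonneg _)
          (pow_le_one₀ (norm_nonneg _) (mem_ball_zero_iff.1 hz).le))
    rw [Metric.tendstoUniformlyOn_iff] at h1 ⊢
    intro ε hε
    set B := Real.sqrt ((1 + Real.pi ^ 2 / 6) * s2NormSq ψ) with hB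
    have hB0 : 0 ≤ B := Real.sqrt_nonneg _
    have h2 := (tendsto_add_atTop_nat 1).eventually (h1 (ε / (B + 1)) (by positivity))
    filter_upwards [h2] with N hN z hz
    have h3 := hN _ (hφm hz)
    rw [(hf.2.1 _ (hφm hz)).tsum_eq] at h3
    have h4 : ‖ψ z‖ ≤ B := Real.le_sqrt_of_sq_le (s2_sup hψ (mem_ball_zero_iff.1 hz))
    rw [dist_eq_norm] at h3 ⊢
    simp only [hF, ← mul_sub, norm_mul]
    calc _ ≤ B * (ε / (B + 1)) := by gcongr
      _ < (B + 1) * (ε / (B + 1)) := by gcongr; linarith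
      _ = ε := by field_simp
  set m := 1 + Real.pi ^ 2 / 6 with hm
  set K := (1 + ‖α‖) / (1 - ‖α‖) with hK
  have hE := s2NormSq_nonneg f
  have hP := s2NormSq_nonneg ψ
  have hS : ∑' n : ℕ, ((n : ℝ) + 1)^2 *
      ‖taylorCoeff (fun z => ψ z * f (c * mob α z)) (n+1)‖^2 ≤
      2 * (m * s2NormSq f) * (s2NormSq ψ - ‖taylorCoeff ψ 0‖ ^ 2) +
      2 * (m * s2NormSq ψ) * (K * s2NormSq f) := by
    apply Real.tsum_le_of_sum_range_le (fun n => by positivity)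
    intro M
    refine le_of_tendsto' (tendsto_finsetSum _ fun n _ =>
      (((aux_coeff_tendsto hgd hFd hu (n + 1)).norm.pow 2).const_mul (((n : ℝ) + 1) ^ 2))) fun N => ?_
    exact aux_mainN hψ hf hc hα N M
  have h0 : ‖taylorCoeff (fun z => ψ z * f (c * mob α z)) 0‖ ^ 2 ≤
      ‖taylorCoeff ψ 0‖ ^ 2 * (m * s2NormSq f) := by
    rw [taylorCoeff_zero, taylorCoeff_zero, norm_mul, mul_pow]
    gcongr
    exact s2_sup hf (mem_ball_zero_iff.1 (hφm (by simp)))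
  have hK1 : 1 ≤ K := by
    rw [hK, le_div_iff₀ (by linarith)]; linarith [norm_nonneg α]
  have hψ0 : ‖taylorCoeff ψ 0‖ ^ 2 ≤ s2NormSq ψ := by
    have := s2_sum hψ 0
    simp at this; linarith
  have hψ00 : 0 ≤ ‖taylorCoeff ψ 0‖ ^ 2 := by positivity
  have hpi : 3 ≤ 2 * Real.pi ^ 2 := by nlinarith [Real.pi_gt_three]
  have hm0 : 0 ≤ m := by positivity
  have hm4 : 4 * m ≤ 1 + 8 * Real.pi ^ 2 / 3 := by rw [hm]; linarith
  unfold s2NormSq at hS ⊢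
  change _ ≤ (1 + 8 * Real.pi ^ 2 / 3) * K * s2NormSq ψ * s2NormSq f
  change _ ≤ 2 * (m * s2NormSq f) * (s2NormSq ψ - ‖taylorCoeff ψ 0‖ ^ 2) +
      2 * (m * s2NormSq ψ) * (K * s2NormSq f) at hS
  have hmE : 0 ≤ m * s2NormSq f := by positivity
  calc _ ≤ 2 * (m * s2NormSq f) * s2NormSq ψ + 2 * (m * s2NormSq ψ) * (K * s2NormSq f) := by
        nlinarith [mul_nonneg hψ00 hmE]
    _ ≤ 2 * (m * s2NormSq f) * s2NormSq ψ * K + 2 * (m * s2NormSq ψ) * (K * s2NormSq f) := by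
        have := le_mul_of_one_le_right
          (show 0 ≤ 2 * (m * s2NormSq f) * s2NormSq ψ by positivity) hK1
        linarith
    _ = (4 * m) * K * s2NormSq ψ * s2NormSq f := by ring
    _ ≤ _ := by gcongr

lemma taylorCoeff_congr {f g : ℂ → ℂ} (h : ∀ z ∈ ball (0:ℂ) 1, f z = g z) (n : ℕ) :
    taylorCoeff f n = taylorCoeff g n := by
  unfold taylorCoeff
  congr 1
  apply Filter.EventuallyEq.iteratedDeriv_eq
  filter_upwards [isOpen_ball.mem_nhds (show (0:ℂ) ∈ ball (0:ℂ) 1 by simp)] with z hz using h z hz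

lemma taylorCoeff_one (n : ℕ) : taylorCoeff (fun _ => (1:ℂ)) n = if n = 0 then 1 else 0 := by
  unfold taylorCoeff
  rw [iteratedDeriv_const]
  split_ifs with h <;> simp [h]

lemma memS2_one : MemS2 (fun _ => (1:ℂ)) := by
  refine ⟨analyticOn_const, fun z _ => ?_, ?_⟩
  · simp_rw [taylorCoeff_one]
    have := hasSum_ite_eq (0:ℕ) (1:ℂ)
    convert! this using 2 with n
    split_ifs with h <;> simp [h]
  · apply summable_of_ne_finset_zero (s := ∅)
    intro n _
    rw [taylorCoeff_one]
    split_ifs with h <;> simp [h]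

lemma s2Norm_one : s2Norm (fun _ => (1:ℂ)) = 1 := by
  simp [s2Norm, s2NormSq, taylorCoeff_one]

theorem weighted_composition_norm_bounds (ψ φ : ℂ → ℂ)
    (hψ : MemS2 ψ) (hφ : IsDiskAut φ) :
    s2Norm ψ ≤ opNormS2 (fun f => fun z => ψ z * f (φ z)) ∧
      opNormS2 (fun f => fun z => ψ z * f (φ z)) ≤
        Real.sqrt ((1 + 8 * Real.pi^2 / 3) * ((1 + ‖φ 0‖) / (1 - ‖φ 0‖))) * s2Norm ψ := by
  obtain ⟨c, α, hc, hα, hφeq⟩ := aux_classify hφ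
  have hφ0 : ‖φ 0‖ = ‖α‖ := by
    rw [hφeq 0 (by simp)]
    simp [mob, hc]
  have hmem : ∀ f, MemS2 f → s2Norm (fun z => ψ z * f (φ z)) ≤
      (Real.sqrt ((1 + 8 * Real.pi^2 / 3) * ((1 + ‖φ 0‖) / (1 - ‖φ 0‖))) * s2Norm ψ) * s2Norm f := by
    intro f hf
    have hcongr : s2NormSq (fun z => ψ z * f (φ z)) = s2NormSq (fun z => ψ z * f (c * mob α z)) := by
      unfold s2NormSq
      have h : ∀ n, taylorCoeff (fun z => ψ z * f (φ z)) n =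
          taylorCoeff (fun z => ψ z * f (c * mob α z)) n :=
        taylorCoeff_congr fun z hz => by rw [hφeq z hz]
      simp_rw [h]
    have hK : 0 ≤ (1 + ‖α‖) / (1 - ‖α‖) := div_nonneg (by positivity) (by linarith)
    have hP := s2NormSq_nonneg ψ
    unfold s2Norm
    rw [hφ0, ← Real.sqrt_mul (by positivity), ← Real.sqrt_mul (by positivity), hcongr]
    exact Real.sqrt_le_sqrt (aux_main hψ hf hc hα)
  have hin : Real.sqrt ((1 + 8 * Real.pi^2 / 3) * ((1 + ‖φ 0‖) / (1 - ‖φ 0‖))) * s2Norm ψ ∈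
      {C : ℝ | 0 ≤ C ∧ ∀ f, MemS2 f → s2Norm ((fun f => fun z => ψ z * f (φ z)) f) ≤ C * s2Norm f} :=
    ⟨mul_nonneg (Real.sqrt_nonneg _) (Real.sqrt_nonneg _), hmem⟩
  constructor
  · apply le_csInf ⟨_, hin⟩
    rintro C ⟨_, hC⟩
    have := hC _ memS2_one
    simpa [s2Norm_one] using this
  · exact csInf_le ⟨0, fun C hC => hC.1⟩ hin
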